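/- arXiv:0806.0870 — 4 statements merged into one kernel-verified Lean document; each statement's English description precedes it below -/
import Mathlib

section
/- Let G be a group acting on a set N, and consider the metamorphosis variational problem with a Lagrangian L on TG × TN that is invariant under the right action (g, η)·h = (gh, h⁻¹η), so that L(g, U_g, η, ξ_η) = ℓ(U_g g⁻¹, gη, gξ_η) for a reduced Lagrangian ℓ(u, n, ν). In the abstract finite-dimensional model of this reduction, let 𝔤 be a finite-dimensional real Lie algebra, V a finite-dimensional Lie module over 𝔤 (so that ⁅u,α⁆·n = u·(α·n) − α·(u·n)), and ℓ : 𝔤 × V × V → ℝ a C² function. Let u : [0,1] → 𝔤 and n, ν : [0,1] → V be C¹ curves satisfying (i) ṅ_t = ν_t + u_t·n_t and (ii) d/dt [D₃ℓ(u_t,n_t,ν_t)] + u_t ⋆ D₃ℓ(u_t,n_t,ν_t) = D₂ℓ(u_t,n_t,ν_t). Then the momentum m_t := D₁ℓ(u_t,n_t,ν_t) + D₃ℓ(u_t,n_t,ν_t) ⋄ n_t satisfies the identity ṁ_t + ad*_{u_t} m_t = d/dt [D₁ℓ(u_t,n_t,ν_t)] + ad*_{u_t} D₁ℓ(u_t,n_t,ν_t)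 + D₂ℓ(u_t,n_t,ν_t) ⋄ n_t + D₃ℓ(u_t,n_t,ν_t) ⋄ ν_t for all t. -/
/-!
Statement 0: in the abstract finite-dimensional model of Euler–Poincaré reduction for
metamorphosis, given the evolution equations (i) `ṅ = ν + u·n` and
(ii) `d/dt D₃ℓ + u ⋆ D₃ℓ = D₂ℓ`, the momentum `m = D₁ℓ + D₃ℓ ⋄ n` satisfies
`ṁ + ad*_u m = d/dt D₁ℓ + ad*_u D₁ℓ + D₂ℓ ⋄ n + D₃ℓ ⋄ ν`.
-/

noncomputable section

variable {G V : Type*}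
  [NormedAddCommGroup G] [NormedSpace ℝ G] [FiniteDimensional ℝ G]
  [NormedAddCommGroup V] [NormedSpace ℝ V] [FiniteDimensional ℝ V]

/-- The diamond operator `δ ⋄ n ∈ 𝔤*`, defined by `(δ ⋄ n) w = −δ (w·n)`,
for an action `ρ` of `𝔤` on `V`. -/
def diamondC (ρ : G →L[ℝ] V →L[ℝ] V) (δ : V →L[ℝ] ℝ) (n : V) : G →L[ℝ] ℝ :=
  -(δ.comp (ρ.flip n))

/-- The star operation `u ⋆ δ ∈ V*`, defined by `(u ⋆ δ) ω = δ (u·ω)`. -/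
def starC (ρ : G →L[ℝ] V →L[ℝ] V) (u : G) (δ : V →L[ℝ] ℝ) : V →L[ℝ] ℝ :=
  δ.comp (ρ u)

/-- The coadjoint operator `ad*_u : 𝔤* → 𝔤*`, `(ad*_u m) α = m ⁅u, α⁆`,
for a Lie bracket `b` on `𝔤`. -/
def coadC (b : G →L[ℝ] G →L[ℝ] G) (u : G) (m : G →L[ℝ] ℝ) : G →L[ℝ] ℝ :=
  m.comp (b u)

theorem metamorphosis_momentum_identity
    -- 𝔤 : finite-dimensional real Lie algebra with bracket `b`
    (b : G →L[ℝ] G →L[ℝ] G)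
    (hb_alt : ∀ x, b x x = 0)
    (hb_jacobi : ∀ x y z, b x (b y z) + b y (b z x) + b z (b x y) = 0)
    -- V : finite-dimensional Lie module over 𝔤, with `⁅u,α⁆·n = u·(α·n) − α·(u·n)`
    (ρ : G →L[ℝ] V →L[ℝ] V)
    (hρ : ∀ u α n, ρ (b u α) n = ρ u (ρ α n) - ρ α (ρ u n))
    -- the reduced Lagrangian, C²
    (ℓ : G × V × V → ℝ) (hℓ : ContDiff ℝ 2 ℓ)
    -- C¹ curves
    (u : ℝ → G) (n ν : ℝ → V)
    (hu : ContDiff ℝ 1 u) (hn : ContDiff ℝ 1 n) (hν : ContDiff ℝ 1 ν)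
    -- the partial derivatives D₁ℓ, D₂ℓ, D₃ℓ along the curves
    (D1 : ℝ → G →L[ℝ] ℝ) (D2 D3 : ℝ → V →L[ℝ] ℝ)
    (hD1 : ∀ t, D1 t = fderiv ℝ (fun x => ℓ (x, n t, ν t)) (u t))
    (hD2 : ∀ t, D2 t = fderiv ℝ (fun x => ℓ (u t, x, ν t)) (n t))
    (hD3 : ∀ t, D3 t = fderiv ℝ (fun x => ℓ (u t, n t, x)) (ν t))
    -- (i): ṅ_t = ν_t + u_t·n_t
    (hsys1 : ∀ t ∈ Set.Icc (0:ℝ) 1, HasDerivAt n (ν t + ρ (u t) (n t)) t)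
    -- (ii): d/dt D₃ℓ + u_t ⋆ D₃ℓ = D₂ℓ
    (hsys2 : ∀ t ∈ Set.Icc (0:ℝ) 1,
      HasDerivAt D3 (D2 t - starC ρ (u t) (D3 t)) t)
    -- d/dt D₁ℓ exists, denoted d1
    (d1 : ℝ → G →L[ℝ] ℝ)
    (hd1 : ∀ t ∈ Set.Icc (0:ℝ) 1, HasDerivAt D1 (d1 t) t)
    -- the momentum m_t = D₁ℓ + D₃ℓ ⋄ n_t
    (m : ℝ → G →L[ℝ] ℝ)
    (hm : ∀ t, m t = D1 t + diamondC ρ (D3 t) (n t)) :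
    -- conclusion: ṁ + ad*_u m = d/dt D₁ℓ + ad*_u D₁ℓ + D₂ℓ ⋄ n + D₃ℓ ⋄ ν
    ∀ t ∈ Set.Icc (0:ℝ) 1,
      HasDerivAt m
        (d1 t + coadC b (u t) (D1 t) + diamondC ρ (D2 t) (n t)
          + diamondC ρ (D3 t) (ν t) - coadC b (u t) (m t)) t := by
  intro t ht
  have hflip : HasDerivAt (fun s => ρ.flip (n s)) (ρ.flip (ν t + ρ (u t) (n t))) t :=
    (ρ.flip.hasFDerivAt (x := n t)).comp_hasDerivAt t (hsys1 t ht)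
  have hcomp := (hd1 t ht).add ((hsys2 t ht).clm_comp hflip).neg
  have hmeq : m = fun s => D1 s + -((D3 s).comp (ρ.flip (n s))) := by
    funext s
    exact hm s
  have hmt := hm t
  rw [hmt, hmeq]
  refine hcomp.congr_deriv ?_
  ext w
  simp only [coadC, diamondC, starC, ContinuousLinearMap.add_apply,
    ContinuousLinearMap.sub_apply, ContinuousLinearMap.neg_apply,
    ContinuousLinearMap.comp_apply, ContinuousLinearMap.flip_apply, hρ, map_add, map_sub]
  ring
end
end

section
/- Let 𝔤 be a finite-dimensional real Lie algebra, V a finite-dimensional Lie module over 𝔤 (so that ⁅u,α⁆·n = u·(α·n) − α·(u·n)), and ℓ : 𝔤 × V × V → ℝ a C² function. Let u : [0,1] → 𝔤 and n, ν : [0,1] → V be C¹ curves satisfying ṅ_t = ν_t + u_t·n_t and d/dt [D₃ℓ(u_t,n_t,ν_t)] + u_t ⋆ D₃ℓ(u_t,n_t,ν_t) = D₂ℓ(u_t,n_t,ν_t) for all t ∈ [0,1]. Then the following two conditions are equivalent (this is the equivalence between the two Euler systems (eq:meta.1) and (eq:meta.2) of the metamorphosis equations): (a) D₁ℓ(u_t,n_t,ν_t)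 + D₃ℓ(u_t,n_t,ν_t) ⋄ n_t = 0 for all t ∈ [0,1]; (b) d/dt [D₁ℓ(u_t,n_t,ν_t)] + ad*_{u_t} D₁ℓ(u_t,n_t,ν_t) + D₂ℓ(u_t,n_t,ν_t) ⋄ n_t + D₃ℓ(u_t,n_t,ν_t) ⋄ ν_t = 0 for all t ∈ [0,1], together with the boundary condition D₁ℓ(u_1,n_1,ν_1) + D₃ℓ(u_1,n_1,ν_1) ⋄ n_1 = 0 at t = 1. -/
/-!
Statement 1: equivalence of the two Euler systems (eq:meta.1) and (eq:meta.2) for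
metamorphosis, in the abstract finite-dimensional model: assuming `ṅ = ν + u·n` and
`d/dt D₃ℓ + u ⋆ D₃ℓ = D₂ℓ`, the condition
(a) `D₁ℓ + D₃ℓ ⋄ n = 0` on `[0,1]`
is equivalent to
(b) `d/dt D₁ℓ + ad*_u D₁ℓ + D₂ℓ ⋄ n + D₃ℓ ⋄ ν = 0` on `[0,1]`, together with the
boundary condition `D₁ℓ(1) + D₃ℓ(1) ⋄ n₁ = 0`.
-/

noncomputable section

variable {G V : Type*}
  [NormedAddCommGroup G] [NormedSpace ℝ G] [FiniteDimensional ℝ G]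
  [NormedAddCommGroup V] [NormedSpace ℝ V] [FiniteDimensional ℝ V]

theorem metamorphosis_euler_systems_equivalent
    -- 𝔤 : finite-dimensional real Lie algebra with bracket `b`
    (b : G →L[ℝ] G →L[ℝ] G)
    (hb_alt : ∀ x, b x x = 0)
    (hb_jacobi : ∀ x y z, b x (b y z) + b y (b z x) + b z (b x y) = 0)
    -- V : finite-dimensional Lie module over 𝔤, with `⁅u,α⁆·n = u·(α·n) − α·(u·n)`
    (ρ : G →L[ℝ] V →L[ℝ] V)
    (hρ : ∀ u α n, ρ (b u α) n = ρ u (ρ α n) - ρ α (ρ u n))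
    -- the reduced Lagrangian, C²
    (ℓ : G × V × V → ℝ) (hℓ : ContDiff ℝ 2 ℓ)
    -- C¹ curves
    (u : ℝ → G) (n ν : ℝ → V)
    (hu : ContDiff ℝ 1 u) (hn : ContDiff ℝ 1 n) (hν : ContDiff ℝ 1 ν)
    -- the partial derivatives D₁ℓ, D₂ℓ, D₃ℓ along the curves
    (D1 : ℝ → G →L[ℝ] ℝ) (D2 D3 : ℝ → V →L[ℝ] ℝ)
    (hD1 : ∀ t, D1 t = fderiv ℝ (fun x => ℓ (x, n t, ν t)) (u t))
    (hD2 : ∀ t, D2 t = fderiv ℝ (fun x => ℓ (u t, x, ν t)) (n t))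
    (hD3 : ∀ t, D3 t = fderiv ℝ (fun x => ℓ (u t, n t, x)) (ν t))
    -- ṅ_t = ν_t + u_t·n_t
    (hsys1 : ∀ t ∈ Set.Icc (0:ℝ) 1, HasDerivAt n (ν t + ρ (u t) (n t)) t)
    -- d/dt D₃ℓ + u_t ⋆ D₃ℓ = D₂ℓ
    (hsys2 : ∀ t ∈ Set.Icc (0:ℝ) 1,
      HasDerivAt D3 (D2 t - starC ρ (u t) (D3 t)) t) :
    -- (a) ⟺ (b) together with the boundary condition at t = 1
    (∀ t ∈ Set.Icc (0:ℝ) 1, D1 t + diamondC ρ (D3 t) (n t) = 0)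
      ↔ ((∀ t ∈ Set.Icc (0:ℝ) 1,
            HasDerivAt D1
              (-(coadC b (u t) (D1 t)) - diamondC ρ (D2 t) (n t)
                - diamondC ρ (D3 t) (ν t)) t)
          ∧ D1 1 + diamondC ρ (D3 1) (n 1) = 0) := by
  have hD1d : Differentiable ℝ D1 := by
    have hc : ContDiff ℝ 1 (fun t => (fderiv ℝ ℓ (u t, n t, ν t)).comp
        (ContinuousLinearMap.inl ℝ G (V × V))) := by
      have h1 : ContDiff ℝ 1 (fderiv ℝ ℓ) := hℓ.fderiv_right (by norm_num)
      have h2 : ContDiff ℝ 1 (fun t => fderiv ℝ ℓ (u t, n t, ν t)) :=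
        h1.comp (hu.prodMk (hn.prodMk hν))
      exact h2.clm_comp contDiff_const
    have he : D1 = (fun t => (fderiv ℝ ℓ (u t, n t, ν t)).comp
        (ContinuousLinearMap.inl ℝ G (V × V))) := by
      funext t
      rw [hD1 t]
      have h1 : HasFDerivAt ℓ (fderiv ℝ ℓ (u t, n t, ν t)) (u t, n t, ν t) :=
        (hℓ.differentiable (by norm_num) _).hasFDerivAt
      exact (h1.comp (u t) (hasFDerivAt_prodMk_left (u t) (n t, ν t))).fderiv
    rw [he]
    exact hc.differentiable (by norm_num)
  -- derivative of the diamond term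
  have hdia : ∀ t ∈ Set.Icc (0:ℝ) 1, HasDerivAt (fun t => diamondC ρ (D3 t) (n t))
      (diamondC ρ (D2 t) (n t) + diamondC ρ (D3 t) (ν t)
        - coadC b (u t) (diamondC ρ (D3 t) (n t))) t := by
    intro t ht
    have h1 : HasDerivAt (fun t => ρ.flip (n t)) (ρ.flip (ν t + ρ (u t) (n t))) t :=
      ρ.flip.hasFDerivAt.comp_hasDerivAt t (hsys1 t ht)
    have h2 := ((hsys2 t ht).clm_comp h1).neg
    refine HasDerivAt.congr_deriv h2 ?_
    ext w
    simp [diamondC, starC, coadC, hρ]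
    ring
  constructor
  · intro ha
    refine ⟨fun t ht => ?_, ha 1 (by simp)⟩
    have h1 := (hdia t ht).neg.hasDerivWithinAt (s := Set.Icc (0:ℝ) 1)
    have hEq : ∀ s ∈ Set.Icc (0:ℝ) 1, D1 s = -diamondC ρ (D3 s) (n s) :=
      fun s hs => eq_neg_of_add_eq_zero_left (ha s hs)
    have h2 := h1.congr hEq (hEq t ht)
    have h3 := (hD1d t).hasDerivAt
    have h4 := (uniqueDiffOn_Icc (zero_lt_one (α := ℝ)) t ht).eq_deriv _
      h3.hasDerivWithinAt h2
    refine h3.congr_deriv (h4.trans ?_)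
    rw [hEq t ht]
    ext w
    simp [coadC]
    ring
  · rintro ⟨hb, h1⟩
    have hM : ∀ t ∈ Set.Icc (0:ℝ) 1, HasDerivAt (fun t => D1 t + diamondC ρ (D3 t) (n t))
        (-(coadC b (u t) (D1 t + diamondC ρ (D3 t) (n t)))) t := by
      intro t ht
      refine ((hb t ht).add (hdia t ht)).congr_deriv ?_
      ext w
      simp [coadC]
      ring
    obtain ⟨C, hC⟩ := isCompact_Icc.exists_bound_of_continuousOn (s := Set.Icc (0:ℝ) 1)
      (f := fun t => b (u t)) (b.continuous.comp hu.continuous).continuousOn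
    have hL : ∀ t ∈ Set.Ioc (0:ℝ) 1, LipschitzOnWith C.toNNReal
        (fun m : G →L[ℝ] ℝ => -(coadC b (u t) m)) Set.univ := by
      intro t ht
      refine (LipschitzWith.of_dist_le_mul fun x y => ?_).lipschitzOnWith
      have hCt := hC t (Set.Ioc_subset_Icc_self ht)
      have hx : -(coadC b (u t) x) - -(coadC b (u t) y) = -((x - y).comp (b (u t))) := by
        ext w
        simp [coadC]
        ring
      rw [dist_eq_norm, dist_eq_norm, hx, norm_neg, mul_comm]
      refine ((x - y).opNorm_comp_le _).trans ?_
      exact mul_le_mul_of_nonneg_left (hCt.trans (Real.le_coe_toNNReal C)) (norm_nonneg _)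
    have hz := ODE_solution_unique_of_mem_Icc_left (a := (0:ℝ)) (b := 1)
      (v := fun t m => -(coadC b (u t) m)) (s := fun _ => Set.univ) (K := C.toNNReal)
      (f := fun t => D1 t + diamondC ρ (D3 t) (n t)) (g := fun _ => 0) hL
      (fun t ht => (hM t ht).continuousAt.continuousWithinAt)
      (fun t ht => (hM t (Set.Ioc_subset_Icc_self ht)).hasDerivWithinAt)
      (fun _ _ => Set.mem_univ _) continuousOn_const
      (fun t _ => by
        have : -(coadC b (u t) 0) = 0 := by simp [coadC]
        rw [this]
        exact hasDerivWithinAt_const _ _ _)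
      (fun _ _ => Set.mem_univ _) h1
    exact fun t ht => hz ht
end
end

section
/- Energy conservation along metamorphosis geodesics (used to extend IVP solutions to all times): Let 𝔤 be a finite-dimensional real vector space with inner product ⟨·,·⟩_𝔤, V a finite-dimensional real vector space with inner product ⟨·,·⟩_V equipped with a bilinear action 𝔤 × V → V, (u, n) ↦ u·n, and let σ > 0. Suppose u : [0,1] → 𝔤 and n, ν : [0,1] → V are C¹ curves satisfying the metamorphosis system for the quadratic Lagrangian ℓ(u, ν) = ½‖u‖²_𝔤 + (1/2σ²)‖ν‖²_V, namely: (i) ⟨u_t, w⟩_𝔤 = (1/σ²)⟨ν_t, w·n_t⟩_V for all w ∈ 𝔤 (i.e. δℓ/δu + (δℓ/δν) ⋄ n_t = 0); (ii) ⟨ν̇_t, ω⟩_V + ⟨ν_t, u_t·ω⟩_V = 0 for all ω ∈ V (i.e. ∂_t(δℓ/δν) + u_t ⋆ (δℓ/δν) = 0); (iii) ṅ_t = ν_t + u_t·n_t. Then the energy h_t := ½‖u_t‖²_𝔤 + (1/2σ²)‖ν_t‖²_V is constant in t. -/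
open scoped RealInnerProductSpace

/-!
Statement 3: energy conservation along metamorphosis geodesics for the quadratic
Lagrangian `ℓ(u, ν) = ½‖u‖²_𝔤 + (1/2σ²)‖ν‖²_V`.
-/

theorem metamorphosis_energy_conservation
    {G V : Type*}
    [NormedAddCommGroup G] [InnerProductSpace ℝ G] [FiniteDimensional ℝ G]
    [NormedAddCommGroup V] [InnerProductSpace ℝ V] [FiniteDimensional ℝ V]
    -- bilinear action of 𝔤 on V
    (ρ : G →L[ℝ] V →L[ℝ] V)
    (σ : ℝ) (hσ : 0 < σ)
    -- C¹ curves u, n, ν with derivatives u', n' (given by (iii)), ν'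
    (u : ℝ → G) (n ν : ℝ → V) (u' : ℝ → G) (ν' : ℝ → V)
    (hu : ∀ t ∈ Set.Icc (0:ℝ) 1, HasDerivAt u (u' t) t)
    (hu' : Continuous u')
    (hν : ∀ t ∈ Set.Icc (0:ℝ) 1, HasDerivAt ν (ν' t) t)
    (hν' : Continuous ν')
    -- (i): ⟪u_t, w⟫_𝔤 = (1/σ²)⟪ν_t, w·n_t⟫_V for all w
    (hi : ∀ t ∈ Set.Icc (0:ℝ) 1, ∀ w : G,
      ⟪u t, w⟫ = (σ ^ 2)⁻¹ * ⟪ν t, ρ w (n t)⟫)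
    -- (ii): ⟪ν̇_t, ω⟫_V + ⟪ν_t, u_t·ω⟫_V = 0 for all ω
    (hii : ∀ t ∈ Set.Icc (0:ℝ) 1, ∀ ω : V,
      ⟪ν' t, ω⟫ + ⟪ν t, ρ (u t) ω⟫ = 0)
    -- (iii): ṅ_t = ν_t + u_t·n_t
    (hiii : ∀ t ∈ Set.Icc (0:ℝ) 1, HasDerivAt n (ν t + ρ (u t) (n t)) t) :
    -- the energy h_t = ½‖u_t‖² + (1/2σ²)‖ν_t‖² is constant on [0,1]
    ∀ s ∈ Set.Icc (0:ℝ) 1, ∀ t ∈ Set.Icc (0:ℝ) 1,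
      (1 / 2) * ‖u s‖ ^ 2 + (1 / (2 * σ ^ 2)) * ‖ν s‖ ^ 2
        = (1 / 2) * ‖u t‖ ^ 2 + (1 / (2 * σ ^ 2)) * ‖ν t‖ ^ 2 := by
  have key : ∀ t ∈ Set.Icc (0:ℝ) 1, ⟪u' t, u t⟫ + (σ ^ 2)⁻¹ * ⟪ν' t, ν t⟫ = 0 := by
    intro t ht
    have h1 : HasDerivWithinAt (fun s => ⟪u s, u t⟫) ⟪u' t, u t⟫ (Set.Icc (0:ℝ) 1) t := by
      have := ((hu t ht).inner ℝ (hasDerivAt_const t (u t))).hasDerivWithinAt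
        (s := Set.Icc (0:ℝ) 1)
      simpa using this
    have h2 : HasDerivWithinAt (fun s => (σ ^ 2)⁻¹ * ⟪ν s, ρ (u t) (n s)⟫)
        ((σ ^ 2)⁻¹ * (⟪ν t, ρ (u t) (ν t + ρ (u t) (n t))⟫ + ⟪ν' t, ρ (u t) (n t)⟫))
        (Set.Icc (0:ℝ) 1) t := by
      have h3 : HasDerivAt (fun s => ρ (u t) (n s)) (ρ (u t) (ν t + ρ (u t) (n t))) t :=
        (ρ (u t)).hasFDerivAt.comp_hasDerivAt t (hiii t ht)
      exact (((hν t ht).inner ℝ h3).const_mul _).hasDerivWithinAt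
    have h4 := h2.congr (fun s hs => hi s hs (u t)) (hi t ht (u t))
    have h5 := (uniqueDiffOn_Icc (zero_lt_one' ℝ) t ht).eq_deriv _ h1 h4
    have h6 := hii t ht (ν t)
    have h7 := hii t ht (ρ (u t) (n t))
    rw [h5, map_add, inner_add_right]
    linear_combination (σ ^ 2)⁻¹ * h6 + (σ ^ 2)⁻¹ * h7
  have hE : ∀ t ∈ Set.Icc (0:ℝ) 1, HasDerivAt
      (fun s => (1 / 2) * ‖u s‖ ^ 2 + (1 / (2 * σ ^ 2)) * ‖ν s‖ ^ 2) 0 t := by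
    intro t ht
    have h := ((hu t ht).norm_sq.const_mul (1 / 2)).add
      ((hν t ht).norm_sq.const_mul (1 / (2 * σ ^ 2)))
    refine h.congr_deriv ?_
    rw [← key t ht, real_inner_comm (u t), real_inner_comm (ν t)]
    field_simp
  have hc := constant_of_has_deriv_right_zero
    (fun t ht => (hE t ht).continuousAt.continuousWithinAt)
    (fun t ht => (hE t (Set.Ico_subset_Icc_self ht)).hasDerivWithinAt)
  intro s hs t ht
  exact (hc s hs).trans (hc t ht).symm
end

section
/- Lax-pair compatibility identity for the 1D image metamorphosis system: Let u, ρ, ψ : ℝ × ℝ → ℝ be smooth (C^∞) functions of (t, x), let λ ∈ ℝ with λ ≠ 0, set m := u − ∂ₓ²u and Q := −1/4 + λ m + λ² ρ². Suppose ψ satisfies the evolution equation ∂_t ψ = −(1/(2λ) + u) ∂ₓ ψ + (1/2)(∂ₓ u) ψ at every point. Define the eigen-equation residual R := ∂ₓ²ψ + Q ψ. Then at every point one has the identity ∂_t R + (1/(2λ) + u) ∂ₓ R + (3/2)(∂ₓ u) R = ψ · [ λ (∂_t m + u ∂ₓ m + 2 m ∂ₓ u + ρ ∂ₓ ρ) +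 2 λ² ρ (∂_t ρ + ∂ₓ(ρ u)) ]. In particular, if (u, ρ) satisfies the 1D image-metamorphosis system ∂_t m + u ∂ₓ m + 2 m ∂ₓ u = −ρ ∂ₓ ρ and ∂_t ρ + ∂ₓ(ρ u) = 0, then R satisfies the homogeneous linear transport equation ∂_t R + (1/(2λ) + u) ∂ₓ R + (3/2)(∂ₓ u) R = 0, so that the eigenvalue equation ∂ₓ²ψ + (−1/4 + mλ + ρ²λ²)ψ = 0 is compatible with the time evolution of ψ. -/
/-!
Statement 5: Lax-pair compatibility identity for the 1D image metamorphosis system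
(SDPsystem1D): with `m = u − ∂ₓ²u`, `Q = −1/4 + λm + λ²ρ²`,
`R = ∂ₓ²ψ + Qψ`, if `ψ` satisfies the evolution equation
`∂ₜψ = −(1/(2λ) + u)∂ₓψ + ½(∂ₓu)ψ`, then
`∂ₜR + (1/(2λ) + u)∂ₓR + (3/2)(∂ₓu)R
  = ψ[λ(∂ₜm + u∂ₓm + 2m∂ₓu + ρ∂ₓρ) + 2λ²ρ(∂ₜρ + ∂ₓ(ρu))]`,
and in particular `R` is transported if `(u, ρ)` solves the system.
-/

noncomputable section

/-- Partial derivative in the first (time) variable. -/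
def pt (f : ℝ × ℝ → ℝ) (p : ℝ × ℝ) : ℝ := deriv (fun s => f (s, p.2)) p.1

/-- Partial derivative in the second (space) variable. -/
def px (f : ℝ × ℝ → ℝ) (p : ℝ × ℝ) : ℝ := deriv (fun y => f (p.1, y)) p.2

theorem px_hasDerivAt {f : ℝ × ℝ → ℝ} (hf : ContDiff ℝ (⊤ : ℕ∞) f) (p : ℝ × ℝ) :
    HasDerivAt (fun y => f (p.1, y)) (fderiv ℝ f p (0, 1)) p.2 := by
  have h1 : HasFDerivAt f (fderiv ℝ f p) (p.1, p.2) :=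
    (hf.differentiable (by simp) p).hasFDerivAt
  exact h1.comp_hasDerivAt p.2 ((hasDerivAt_const p.2 p.1).prodMk (hasDerivAt_id p.2))

theorem pt_hasDerivAt {f : ℝ × ℝ → ℝ} (hf : ContDiff ℝ (⊤ : ℕ∞) f) (p : ℝ × ℝ) :
    HasDerivAt (fun s => f (s, p.2)) (fderiv ℝ f p (1, 0)) p.1 := by
  have h1 : HasFDerivAt f (fderiv ℝ f p) (p.1, p.2) :=
    (hf.differentiable (by simp) p).hasFDerivAt
  exact h1.comp_hasDerivAt p.1 ((hasDerivAt_id p.1).prodMk (hasDerivAt_const p.1 p.2))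

theorem px_eq {f : ℝ × ℝ → ℝ} (hf : ContDiff ℝ (⊤ : ℕ∞) f) :
    px f = fun p => fderiv ℝ f p (0, 1) := funext fun p => (px_hasDerivAt hf p).deriv

theorem pt_eq {f : ℝ × ℝ → ℝ} (hf : ContDiff ℝ (⊤ : ℕ∞) f) :
    pt f = fun p => fderiv ℝ f p (1, 0) := funext fun p => (pt_hasDerivAt hf p).deriv

theorem fd_smooth {f : ℝ × ℝ → ℝ} (hf : ContDiff ℝ (⊤ : ℕ∞) f) :
    ContDiff ℝ (⊤ : ℕ∞) (fderiv ℝ f) := hf.fderiv_right (by simp)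

theorem px_smooth {f : ℝ × ℝ → ℝ} (hf : ContDiff ℝ (⊤ : ℕ∞) f) :
    ContDiff ℝ (⊤ : ℕ∞) (px f) := by
  rw [px_eq hf]; exact (fd_smooth hf).clm_apply contDiff_const

theorem pt_smooth {f : ℝ × ℝ → ℝ} (hf : ContDiff ℝ (⊤ : ℕ∞) f) :
    ContDiff ℝ (⊤ : ℕ∞) (pt f) := by
  rw [pt_eq hf]; exact (fd_smooth hf).clm_apply contDiff_const

theorem fd_apply {f : ℝ × ℝ → ℝ} (hf : ContDiff ℝ (⊤ : ℕ∞) f) (v w p : ℝ × ℝ) :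
    fderiv ℝ (fun q => fderiv ℝ f q v) p w = fderiv ℝ (fderiv ℝ f) p w v := by
  have h := ((fd_smooth hf).differentiable (by simp) p).hasFDerivAt.clm_apply
    (hasFDerivAt_const v p)
  rw [h.fderiv]; simp

theorem pt_px {f : ℝ × ℝ → ℝ} (hf : ContDiff ℝ (⊤ : ℕ∞) f) : pt (px f) = px (pt f) := by
  rw [pt_eq (px_smooth hf), px_eq (pt_smooth hf), px_eq hf, pt_eq hf]
  funext p
  rw [fd_apply hf, fd_apply hf]
  have h : IsSymmSndFDerivAt ℝ f p :=
    hf.contDiffAt.isSymmSndFDerivAt (by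
      simp only [minSmoothness_of_isRCLikeNormedField]; exact WithTop.coe_le_coe.2 (le_top : (2 : ℕ∞) ≤ ⊤))
  exact h _ _

theorem px_add {f g : ℝ × ℝ → ℝ} (hf : ContDiff ℝ (⊤ : ℕ∞) f) (hg : ContDiff ℝ (⊤ : ℕ∞) g) :
    px (f + g) = px f + px g := by
  funext p
  have h := (px_hasDerivAt hf p).add (px_hasDerivAt hg p)
  simp only [Pi.add_apply, px_eq hf, px_eq hg]
  exact h.deriv

theorem pt_add {f g : ℝ × ℝ → ℝ} (hf : ContDiff ℝ (⊤ : ℕ∞) f) (hg : ContDiff ℝ (⊤ : ℕ∞) g) :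
    pt (f + g) = pt f + pt g := by
  funext p
  have h := (pt_hasDerivAt hf p).add (pt_hasDerivAt hg p)
  simp only [Pi.add_apply, pt_eq hf, pt_eq hg]
  exact h.deriv

theorem px_mul {f g : ℝ × ℝ → ℝ} (hf : ContDiff ℝ (⊤ : ℕ∞) f) (hg : ContDiff ℝ (⊤ : ℕ∞) g) :
    px (f * g) = px f * g + f * px g := by
  funext p
  have h := (px_hasDerivAt hf p).mul (px_hasDerivAt hg p)
  simp only [Pi.add_apply, Pi.mul_apply, px_eq hf, px_eq hg]
  exact h.deriv

theorem pt_mul {f g : ℝ × ℝ → ℝ} (hf : ContDiff ℝ (⊤ : ℕ∞) f) (hg : ContDiff ℝ (⊤ : ℕ∞) g) :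
    pt (f * g) = pt f * g + f * pt g := by
  funext p
  have h := (pt_hasDerivAt hf p).mul (pt_hasDerivAt hg p)
  simp only [Pi.add_apply, Pi.mul_apply, pt_eq hf, pt_eq hg]
  exact h.deriv

/-- Constant functions. -/
def cst (c : ℝ) : ℝ × ℝ → ℝ := fun _ => c

theorem cst_smooth (c : ℝ) : ContDiff ℝ (⊤ : ℕ∞) (cst c) := contDiff_const

theorem px_cst (c : ℝ) : px (cst c) = 0 := by funext p; simp [px, cst]

theorem pt_cst (c : ℝ) : pt (cst c) = 0 := by funext p; simp [pt, cst]

theorem ContDiff.addPi {f g : ℝ × ℝ → ℝ} (hf : ContDiff ℝ (⊤ : ℕ∞) f)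
    (hg : ContDiff ℝ (⊤ : ℕ∞) g) : ContDiff ℝ (⊤ : ℕ∞) (f + g) := hf.add hg

theorem ContDiff.mulPi {f g : ℝ × ℝ → ℝ} (hf : ContDiff ℝ (⊤ : ℕ∞) f)
    (hg : ContDiff ℝ (⊤ : ℕ∞) g) : ContDiff ℝ (⊤ : ℕ∞) (f * g) := hf.mul hg

theorem lax_pair_compatibility
    (u ρ ψ : ℝ × ℝ → ℝ)
    (hu : ContDiff ℝ (⊤ : ℕ∞) u) (hρ : ContDiff ℝ (⊤ : ℕ∞) ρ) (hψ : ContDiff ℝ (⊤ : ℕ∞) ψ)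
    (l : ℝ) (hl : l ≠ 0)
    (m : ℝ × ℝ → ℝ) (hm : m = fun p => u p - px (px u) p)
    (Q : ℝ × ℝ → ℝ) (hQ : Q = fun p => -(1 / 4) + l * m p + l ^ 2 * (ρ p) ^ 2)
    -- evolution equation for ψ
    (hψev : ∀ p, pt ψ p = -((1 / (2 * l) + u p) * px ψ p) + (1 / 2) * px u p * ψ p)
    -- eigen-equation residual
    (R : ℝ × ℝ → ℝ) (hR : R = fun p => px (px ψ) p + Q p * ψ p) :
    -- the pointwise identity
    (∀ p, pt R p + (1 / (2 * l) + u p) * px R p + (3 / 2) * px u p * R p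
        = ψ p * (l * (pt m p + u p * px m p + 2 * m p * px u p + ρ p * px ρ p)
            + 2 * l ^ 2 * ρ p * (pt ρ p + px (fun q => ρ q * u q) p)))
    -- in particular: if (u, ρ) solves the 1D image-metamorphosis system, then R is
    -- transported by the homogeneous linear equation
    ∧ ((∀ p, pt m p + u p * px m p + 2 * m p * px u p = -(ρ p * px ρ p)) →
        (∀ p, pt ρ p + px (fun q => ρ q * u q) p = 0) →
        ∀ p, pt R p + (1 / (2 * l) + u p) * px R p + (3 / 2) * px u p * R p = 0) := by
  have key : ∀ p, pt R p + (1 / (2 * l) + u p) * px R p + (3 / 2) * px u p * R p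
        = ψ p * (l * (pt m p + u p * px m p + 2 * m p * px u p + ρ p * px ρ p)
            + 2 * l ^ 2 * ρ p * (pt ρ p + px (fun q => ρ q * u q) p)) := by
    have hux := px_smooth hu
    have huxx := px_smooth hux
    have hψx := px_smooth hψ
    have hψxx := px_smooth hψx
    have hc := cst_smooth
    have hm' : m = u + cst (-1) * px (px u) := by
      rw [hm]; funext p; simp [cst]; ring
    have hms : ContDiff ℝ (⊤ : ℕ∞) m := by rw [hm']; exact hu.addPi ((hc _).mulPi huxx)
    have hQ' : Q = cst (-(1 / 4)) + (cst l * m + cst (l ^ 2) * (ρ * ρ)) := by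
      rw [hQ]; funext p; simp [cst]; ring
    have hρρ : ContDiff ℝ (⊤ : ℕ∞) (ρ * ρ) := hρ.mulPi hρ
    have hlm : ContDiff ℝ (⊤ : ℕ∞) (cst l * m) := (hc _).mulPi hms
    have hlr : ContDiff ℝ (⊤ : ℕ∞) (cst (l ^ 2) * (ρ * ρ)) := (hc _).mulPi hρρ
    have hQ2 : ContDiff ℝ (⊤ : ℕ∞) (cst l * m + cst (l ^ 2) * (ρ * ρ)) := hlm.addPi hlr
    have hQs : ContDiff ℝ (⊤ : ℕ∞) Q := by rw [hQ']; exact (hc _).addPi hQ2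
    have hR' : R = px (px ψ) + Q * ψ := by rw [hR]; rfl
    have hQψ : ContDiff ℝ (⊤ : ℕ∞) (Q * ψ) := hQs.mulPi hψ
    have hρu : (fun q => ρ q * u q) = ρ * u := rfl
    have mx : px m = px u + cst (-1) * px (px (px u)) := by
      rw [hm', px_add hu ((hc _).mulPi huxx), px_mul (hc _) huxx, px_cst]; simp
    have Qx : px Q = cst l * px m + cst (l ^ 2) * (px ρ * ρ + ρ * px ρ) := by
      rw [hQ', px_add (hc _) hQ2, px_add hlm hlr, px_mul (hc _) hms, px_mul (hc _) hρρ,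
        px_mul hρ hρ, px_cst, px_cst, px_cst]; simp
    have Qt : pt Q = cst l * pt m + cst (l ^ 2) * (pt ρ * ρ + ρ * pt ρ) := by
      rw [hQ', pt_add (hc _) hQ2, pt_add hlm hlr, pt_mul (hc _) hms, pt_mul (hc _) hρρ,
        pt_mul hρ hρ, pt_cst, pt_cst, pt_cst]; simp
    have hb : ContDiff ℝ (⊤ : ℕ∞) (cst (-(1 / (2 * l))) + cst (-1) * u) :=
      (hc _).addPi ((hc _).mulPi hu)
    have bx : px (cst (-(1 / (2 * l))) + cst (-1) * u) = cst (-1) * px u := by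
      rw [px_add (hc _) ((hc _).mulPi hu), px_mul (hc _) hu, px_cst, px_cst]; simp
    have hd : ContDiff ℝ (⊤ : ℕ∞) (cst (1 / 2) * px u) := (hc _).mulPi hux
    have dx : px (cst (1 / 2) * px u) = cst (1 / 2) * px (px u) := by
      rw [px_mul (hc _) hux, px_cst]; simp
    have hd2 : ContDiff ℝ (⊤ : ℕ∞) (cst (1 / 2) * px (px u)) := (hc _).mulPi huxx
    have dxx : px (cst (1 / 2) * px (px u)) = cst (1 / 2) * px (px (px u)) := by
      rw [px_mul (hc _) huxx, px_cst]; simp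
    have hb2 : ContDiff ℝ (⊤ : ℕ∞) (cst (-1) * px u) := (hc _).mulPi hux
    have bxx : px (cst (-1) * px u) = cst (-1) * px (px u) := by
      rw [px_mul (hc _) hux, px_cst]; simp
    have ψt : pt ψ = (cst (-(1 / (2 * l))) + cst (-1) * u) * px ψ + cst (1 / 2) * px u * ψ := by
      funext p; rw [hψev]; simp [cst]; ring
    have ψxxt : pt (px (px ψ)) = px (px (pt ψ)) := by rw [pt_px hψx, pt_px hψ]
    rw [ψt, px_add (hb.mulPi hψx) (hd.mulPi hψ), px_mul hb hψx, px_mul hd hψ, bx, dx,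
      px_add ((hb2.mulPi hψx).addPi (hb.mulPi hψxx)) ((hd2.mulPi hψ).addPi (hd.mulPi hψx)),
      px_add (hb2.mulPi hψx) (hb.mulPi hψxx), px_add (hd2.mulPi hψ) (hd.mulPi hψx),
      px_mul hb2 hψx, px_mul hb hψxx, px_mul hd2 hψ, px_mul hd hψx, bx, dx, bxx, dxx] at ψxxt
    intro p
    rw [hρu, px_mul hρ hu, hR', pt_add hψxx hQψ, px_add hψxx hQψ, pt_mul hQs hψ, px_mul hQs hψ,
      ψxxt, ψt, Qt, Qx, mx]
    simp only [Pi.add_apply, Pi.mul_apply, cst, hQ]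
    simp only [hm]
    field_simp
    ring
  refine ⟨key, fun h1 h2 p => ?_⟩
  rw [key p, h1 p, h2 p]
  ring
end
end
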